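/- Let M = ⟨S, A, P, R, H, ρ₀⟩ be a finite-horizon episodic MDP with expert policy π_e, and suppose Ŝ ⊆ S contains every state with positive hitting probability, i.e. Ŝ ⊇ {s ∈ S : h(s) > 0}. Let M̂ be the corresponding e-stop MDP and let π̂* be a policy maximizing J_{M̂} over all policies. Then J_M(π̂*) ≥ J_M(π_e): the optimal policy of the e-stop MDP achieves at least the expert's expected cumulative reward in the true MDP M. -/

import Mathlib

open Finset

/-- A finite-horizon episodic MDP `⟨S, A, P, R, H, ρ₀⟩`. -/
structure MDP (S A : Type*) [Fintype S] [Fintype A] where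
  P : S → A → S → ℝ
  P_nonneg : ∀ s a s', 0 ≤ P s a s'
  P_sum : ∀ s a, ∑ s' : S, P s a s' = 1
  R : S → A → S → ℝ
  R_nonneg : ∀ s a s', 0 ≤ R s a s'
  R_le_one : ∀ s a s', R s a s' ≤ 1
  H : ℕ
  H_pos : 0 < H
  ρ0 : S → ℝ
  ρ0_nonneg : ∀ s, 0 ≤ ρ0 s
  ρ0_sum : ∑ s : S, ρ0 s = 1

/-- A (time-dependent, stochastic) policy. -/
structure Policy (S A : Type*) [Fintype A] where
  p : ℕ → S → A → ℝ
  nonneg : ∀ t s a, 0 ≤ p t s a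
  sum_one : ∀ t s, ∑ a : A, p t s a = 1

/-- The time-`t` state distribution `ρ_π^t`. -/
noncomputable def stateDist {S A : Type*} [Fintype S] [Fintype A]
    (P : S → A → S → ℝ) (pol : ℕ → S → A → ℝ) (ρ0 : S → ℝ) : ℕ → S → ℝ
  | 0 => ρ0
  | t + 1 => fun s => ∑ s' : S, ∑ a : A, stateDist P pol ρ0 t s' * pol t s' a * P s' a s

/-- Expected cumulative reward `J = ∑_{t=0}^{H-2} ∑_{s,a,s'} ρ^t(s) π(a|s,t) P(s,a,s') R(s,a,s')`. -/
noncomputable def valueJ {S A : Type*} [Fintype S] [Fintype A]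
    (P : S → A → S → ℝ) (R : S → A → S → ℝ) (H : ℕ) (ρ0 : S → ℝ)
    (pol : ℕ → S → A → ℝ) : ℝ :=
  ∑ t ∈ Finset.range (H - 1), ∑ s : S, ∑ a : A, ∑ s' : S,
    stateDist P pol ρ0 t s * pol t s a * P s a s' * R s a s'

/-- `J_M(π)`. -/
noncomputable def MDP.J {S A : Type*} [Fintype S] [Fintype A]
    (M : MDP S A) (π : Policy S A) : ℝ :=
  valueJ M.P M.R M.H M.ρ0 π.p

/-- State space `Ŝ ∪ {s_term}` of the e-stop MDP; `none` is the absorbing state `s_term`. -/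
abbrev EState (S : Type*) (Shat : Finset S) := Option {s : S // s ∈ Shat}

/-- Transition kernel of the e-stop MDP. -/
noncomputable def estopP {S A : Type*} [Fintype S] [DecidableEq S]
    (P : S → A → S → ℝ) (Shat : Finset S) :
    EState S Shat → A → EState S Shat → ℝ
  | some s, a, some s' => P s.1 a s'.1
  | some s, a, none => ∑ s' ∈ Shatᶜ, P s.1 a s'
  | none, _, some _ => 0
  | none, _, none => 1

/-- Reward of the e-stop MDP: zero on any transition into or out of `s_term`. -/
noncomputable def estopR {S A : Type*} (R : S → A → S → ℝ) (Shat : Finset S) :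
    EState S Shat → A → EState S Shat → ℝ
  | some s, a, some s' => R s.1 a s'.1
  | _, _, _ => 0

/-- Initial distribution of the e-stop MDP. -/
noncomputable def estopρ0 {S : Type*} [Fintype S] [DecidableEq S]
    (ρ0 : S → ℝ) (Shat : Finset S) : EState S Shat → ℝ
  | some s => ρ0 s.1
  | none => ∑ s ∈ Shatᶜ, ρ0 s

/-- The policy induced on the e-stop MDP by restriction (acting uniformly at `s_term`). -/
noncomputable def estopPol {S A : Type*} [Fintype A]
    (pol : ℕ → S → A → ℝ) (Shat : Finset S) :
    ℕ → EState S Shat → A → ℝ :=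
  fun t s a => match s with
    | some s => pol t s.1 a
    | none => (Fintype.card A : ℝ)⁻¹

/-- `J_{M̂}(π)`: expected cumulative reward of (the restriction of) `π` in the e-stop MDP. -/
noncomputable def estopJ {S A : Type*} [Fintype S] [DecidableEq S] [Fintype A]
    (M : MDP S A) (Shat : Finset S) (π : Policy S A) : ℝ :=
  valueJ (estopP M.P Shat) (estopR M.R Shat) M.H (estopρ0 M.ρ0 Shat) (estopPol π.p Shat)

/-- Probability of the trajectory `τ = (τ₀, …, τ_{H-1})` under policy `π` in `M`. -/
noncomputable def trajProb {S A : Type*} [Fintype S] [Fintype A]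
    (M : MDP S A) (π : Policy S A) (τ : Fin M.H → S) : ℝ :=
  M.ρ0 (τ ⟨0, M.H_pos⟩) *
    ∏ t : Fin (M.H - 1), ∑ a : A,
      π.p t.1 (τ ⟨t.1, Nat.lt_of_lt_of_le t.2 (Nat.sub_le _ _)⟩) a *
        M.P (τ ⟨t.1, Nat.lt_of_lt_of_le t.2 (Nat.sub_le _ _)⟩) a
          (τ ⟨t.1 + 1, by have := t.2; omega⟩)

/-- Hitting probability `h(s)`: the probability that `π` visits `s` during an episode. -/
noncomputable def hitProb {S A : Type*} [Fintype S] [DecidableEq S] [Fintype A]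
    (M : MDP S A) (π : Policy S A) (s : S) : ℝ :=
  ∑ τ : Fin M.H → S, trajProb M π τ * (if ∃ t, τ t = s then 1 else 0)

/-- Average state distribution `ρ_π(s) = (1/H) ∑_{t=0}^{H-1} ρ_π^t(s)`. -/
noncomputable def avgDist {S A : Type*} [Fintype S] [Fintype A]
    (M : MDP S A) (π : Policy S A) (s : S) : ℝ :=
  (M.H : ℝ)⁻¹ * ∑ t ∈ Finset.range M.H, stateDist M.P π.p M.ρ0 t s

lemma stateDist_nonneg {S A : Type*} [Fintype S] [Fintype A] (M : MDP S A) (π : Policy S A)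
    (t : ℕ) (s : S) : 0 ≤ stateDist M.P π.p M.ρ0 t s := by
  induction t generalizing s with
  | zero => exact M.ρ0_nonneg s
  | succ t ih =>
    exact sum_nonneg fun s' _ => sum_nonneg fun a _ =>
      mul_nonneg (mul_nonneg (ih s') (π.nonneg _ _ _)) (M.P_nonneg _ _ _)

/-- One-step transition probability of `M` under the policy `π` at time `t`. -/
noncomputable def stepProb {S A : Type*} [Fintype S] [Fintype A]
    (M : MDP S A) (π : Policy S A) (t : ℕ) (s s' : S) : ℝ :=
  ∑ a : A, π.p t s a * M.P s a s'

lemma stepProb_nonneg {S A : Type*} [Fintype S] [Fintype A] (M : MDP S A) (π : Policy S A)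
    (t : ℕ) (s s' : S) : 0 ≤ stepProb M π t s s' :=
  sum_nonneg fun _ _ => mul_nonneg (π.nonneg _ _ _) (M.P_nonneg _ _ _)

lemma sum_stepProb {S A : Type*} [Fintype S] [Fintype A] (M : MDP S A) (π : Policy S A)
    (t : ℕ) (s : S) : ∑ s' : S, stepProb M π t s s' = 1 := by
  unfold stepProb
  rw [sum_comm]
  simp only [← mul_sum, M.P_sum, mul_one, π.sum_one]

lemma exists_stepProb_pos {S A : Type*} [Fintype S] [Fintype A] (M : MDP S A) (π : Policy S A)
    (t : ℕ) (s : S) : ∃ s', 0 < stepProb M π t s s' := by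
  by_contra! h
  have := sum_stepProb M π t s
  have : ∑ s' : S, stepProb M π t s s' ≤ 0 := sum_nonpos fun s' _ => h s'
  linarith

lemma stateDist_succ {S A : Type*} [Fintype S] [Fintype A] (M : MDP S A) (π : Policy S A)
    (t : ℕ) (s : S) : stateDist M.P π.p M.ρ0 (t + 1) s =
      ∑ s' : S, stateDist M.P π.p M.ρ0 t s' * stepProb M π t s' s := by
  simp only [stateDist, stepProb, mul_sum, mul_assoc]

/-- A path that starts in the support of the initial distribution and makes its first `n`
transitions with positive probability. -/
def IsPositivePath {S A : Type*} [Fintype S] [Fintype A]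
    (M : MDP S A) (π : Policy S A) (n : ℕ) (f : ℕ → S) : Prop :=
  0 < M.ρ0 (f 0) ∧ ∀ i < n, 0 < stepProb M π i (f i) (f (i + 1))

lemma IsPositivePath.update {S A : Type*} [Fintype S] [Fintype A]
    {M : MDP S A} {π : Policy S A} {n : ℕ} {f : ℕ → S} (hf : IsPositivePath M π n f)
    {s : S} (hs : 0 < stepProb M π n (f n) s) :
    IsPositivePath M π (n + 1) (Function.update f (n + 1) s) := by
  refine ⟨by rw [Function.update_of_ne (by omega)]; exact hf.1, fun i hi => ?_⟩
  rw [Function.update_of_ne (by omega)]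
  rcases Nat.lt_succ_iff_lt_or_eq.mp hi with h | rfl
  · rw [Function.update_of_ne (by omega)]
    exact hf.2 i h
  · simpa using hs

lemma exists_isPositivePath_of_stateDist_pos {S A : Type*} [Fintype S] [Fintype A]
    (M : MDP S A) (π : Policy S A) (t : ℕ) (s : S) (h : 0 < stateDist M.P π.p M.ρ0 t s) :
    ∃ f, IsPositivePath M π t f ∧ f t = s := by
  induction t generalizing s with
  | zero => exact ⟨fun _ => s, ⟨h, by simp⟩, rfl⟩
  | succ t ih =>
    rw [stateDist_succ] at h
    obtain ⟨s', -, hs'⟩ := exists_lt_of_sum_lt (s := univ) (f := fun _ : S => (0 : ℝ))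
      (by simpa using h)
    have h1 := pos_of_mul_pos_left hs' (stepProb_nonneg M π t s' s)
    obtain ⟨f, hf, rfl⟩ := ih s' h1
    exact ⟨_, hf.update (pos_of_mul_pos_right hs' h1.le), by simp⟩

lemma IsPositivePath.exists_extension {S A : Type*} [Fintype S] [Fintype A]
    {M : MDP S A} {π : Policy S A} {t : ℕ} {f : ℕ → S} (hf : IsPositivePath M π t f)
    {n : ℕ} (hn : t ≤ n) : ∃ g, IsPositivePath M π n g ∧ g t = f t := by
  induction n, hn using Nat.le_induction with
  | base => exact ⟨f, hf, rfl⟩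
  | succ n hn ih =>
    obtain ⟨g, hg, hgt⟩ := ih
    obtain ⟨s, hs⟩ := exists_stepProb_pos M π n (g n)
    exact ⟨_, hg.update hs, by rw [Function.update_of_ne (by omega), hgt]⟩

lemma trajProb_nonneg {S A : Type*} [Fintype S] [Fintype A] (M : MDP S A) (π : Policy S A)
    (τ : Fin M.H → S) : 0 ≤ trajProb M π τ :=
  mul_nonneg (M.ρ0_nonneg _) (prod_nonneg fun _ _ => stepProb_nonneg M π _ _ _)

lemma hitProb_pos_of_stateDist_pos {S A : Type*} [Fintype S] [DecidableEq S] [Fintype A]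
    (M : MDP S A) (π : Policy S A) {t : ℕ} (ht : t < M.H) {s : S}
    (h : 0 < stateDist M.P π.p M.ρ0 t s) : 0 < hitProb M π s := by
  obtain ⟨f, hf, rfl⟩ := exists_isPositivePath_of_stateDist_pos M π t s h
  obtain ⟨g, hg, hgt⟩ := hf.exists_extension (Nat.le_sub_one_of_lt ht)
  refine sum_pos' (fun τ _ => mul_nonneg (trajProb_nonneg M π τ) (by split_ifs <;> simp))
    ⟨fun i => g i, mem_univ _, ?_⟩
  rw [if_pos ⟨⟨t, ht⟩, hgt⟩, mul_one]
  exact mul_pos hg.1 (prod_pos fun i _ => hg.2 i i.2)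

lemma stateDist_estop_succ {S A : Type*} [Fintype S] [DecidableEq S] [Fintype A]
    (M : MDP S A) (Shat : Finset S) (π : Policy S A) (t : ℕ) (s : {s : S // s ∈ Shat}) :
    stateDist (estopP M.P Shat) (estopPol π.p Shat) (estopρ0 M.ρ0 Shat) (t + 1) (some s) =
      ∑ s' : {s : S // s ∈ Shat}, ∑ a : A,
        stateDist (estopP M.P Shat) (estopPol π.p Shat) (estopρ0 M.ρ0 Shat) t (some s') *
          π.p t s' a * M.P s' a s := by
  simp [stateDist, Fintype.sum_option, estopP, estopPol]

lemma estopJ_eq_sum {S A : Type*} [Fintype S] [DecidableEq S] [Fintype A]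
    (M : MDP S A) (Shat : Finset S) (π : Policy S A) :
    estopJ M Shat π = ∑ t ∈ range (M.H - 1), ∑ s : {s : S // s ∈ Shat}, ∑ a : A,
      ∑ s' : {s : S // s ∈ Shat},
        stateDist (estopP M.P Shat) (estopPol π.p Shat) (estopρ0 M.ρ0 Shat) t (some s) *
          π.p t s a * M.P s a s' * M.R s a s' := by
  simp [estopJ, valueJ, Fintype.sum_option, estopP, estopPol, estopR]

lemma sum_subtype_le_sum {S : Type*} [Fintype S] (Shat : Finset S) {f : S → ℝ}
    (hf : ∀ s, 0 ≤ f s) : ∑ s : {s : S // s ∈ Shat}, f s ≤ ∑ s : S, f s := by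
  rw [sum_coe_sort Shat f]
  exact sum_le_univ_sum_of_nonneg hf

lemma sum_subtype_eq_sum {S : Type*} [Fintype S] (Shat : Finset S) {f : S → ℝ}
    (hf : ∀ s, s ∉ Shat → f s = 0) : ∑ s : {s : S // s ∈ Shat}, f s = ∑ s : S, f s := by
  rw [sum_coe_sort Shat f]
  exact sum_subset (subset_univ _) fun s _ hs => hf s hs

lemma stateDist_estop_le {S A : Type*} [Fintype S] [DecidableEq S] [Fintype A]
    (M : MDP S A) (Shat : Finset S) (π : Policy S A) (t : ℕ) (s : {s : S // s ∈ Shat}) :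
    stateDist (estopP M.P Shat) (estopPol π.p Shat) (estopρ0 M.ρ0 Shat) t (some s) ≤
      stateDist M.P π.p M.ρ0 t s := by
  induction t generalizing s with
  | zero => exact le_rfl
  | succ t ih =>
    rw [stateDist_estop_succ]
    refine le_trans ?_ (sum_subtype_le_sum Shat fun s' => sum_nonneg fun a _ =>
      mul_nonneg (mul_nonneg (stateDist_nonneg M π t s') (π.nonneg _ _ _)) (M.P_nonneg _ _ _))
    refine sum_le_sum fun s' _ => sum_le_sum fun a _ => ?_
    have := π.nonneg t s' a
    have := M.P_nonneg s' a s
    gcongr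
    exact ih s'

lemma stateDist_estop_eq {S A : Type*} [Fintype S] [DecidableEq S] [Fintype A]
    (M : MDP S A) (Shat : Finset S) (π : Policy S A) (t : ℕ)
    (h : ∀ i < t, ∀ s, s ∉ Shat → stateDist M.P π.p M.ρ0 i s = 0) (s : {s : S // s ∈ Shat}) :
    stateDist (estopP M.P Shat) (estopPol π.p Shat) (estopρ0 M.ρ0 Shat) t (some s) =
      stateDist M.P π.p M.ρ0 t s := by
  induction t generalizing s with
  | zero => rfl
  | succ t ih =>
    rw [stateDist_estop_succ]
    simp only [ih fun i hi => h i (by omega)]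
    exact sum_subtype_eq_sum Shat
      (f := fun s' => ∑ a : A, stateDist M.P π.p M.ρ0 t s' * π.p t s' a * M.P s' a s)
      fun x hx => by simp [h t (by omega) x hx]

/-- Early stopping never increases the value of a policy. -/
lemma estopJ_le_J {S A : Type*} [Fintype S] [DecidableEq S] [Fintype A]
    (M : MDP S A) (Shat : Finset S) (π : Policy S A) : estopJ M Shat π ≤ M.J π := by
  rw [estopJ_eq_sum]
  have hnn (t : ℕ) (s : S) (a : A) (s' : S) :
      0 ≤ stateDist M.P π.p M.ρ0 t s * π.p t s a * M.P s a s' * M.R s a s' :=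
    mul_nonneg (mul_nonneg (mul_nonneg (stateDist_nonneg M π t s) (π.nonneg _ _ _))
      (M.P_nonneg _ _ _)) (M.R_nonneg _ _ _)
  refine sum_le_sum fun t _ => le_trans (sum_le_sum fun s _ => sum_le_sum fun a _ => ?_)
    (sum_subtype_le_sum Shat fun s => sum_nonneg fun a _ => sum_nonneg fun s' _ => hnn t s a s')
  refine le_trans (sum_le_sum fun s' _ => ?_) (sum_subtype_le_sum Shat (hnn t s a))
  have := π.nonneg t s a
  have := M.P_nonneg s a s'
  have := M.R_nonneg s a s'
  gcongr
  exact stateDist_estop_le M Shat π t s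

/-- Early stopping does not change the value of a policy that stays in `Shat`. -/
lemma estopJ_eq_J {S A : Type*} [Fintype S] [DecidableEq S] [Fintype A]
    (M : MDP S A) (Shat : Finset S) (π : Policy S A)
    (h : ∀ t < M.H, ∀ s, s ∉ Shat → stateDist M.P π.p M.ρ0 t s = 0) :
    estopJ M Shat π = M.J π := by
  rw [estopJ_eq_sum]
  refine sum_congr rfl fun t ht => ?_
  have ht' : t + 1 < M.H := by have := mem_range.mp ht; omega
  rw [← sum_subtype_eq_sum Shat fun s hs => by simp [h t (by omega) s hs]]
  refine sum_congr rfl fun s _ => sum_congr rfl fun a _ => ?_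
  rw [stateDist_estop_eq M Shat π t (fun i hi => h i (by omega)) s]
  refine sum_subtype_eq_sum Shat
    (f := fun s' => stateDist M.P π.p M.ρ0 t s * π.p t s a * M.P s a s' * M.R s a s')
    fun s' hs' => ?_
  have hterm (x : S) (b : A) : 0 ≤ stateDist M.P π.p M.ρ0 t x * π.p t x b * M.P x b s' :=
    mul_nonneg (mul_nonneg (stateDist_nonneg M π t x) (π.nonneg _ _ _)) (M.P_nonneg _ _ _)
  have hzero := h (t + 1) ht' s' hs'
  rw [stateDist, sum_eq_zero_iff_of_nonneg fun x _ => sum_nonneg fun b _ => hterm x b] at hzero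
  have hzero' := (sum_eq_zero_iff_of_nonneg fun b _ => hterm s b).mp (hzero s (mem_univ _)) a
    (mem_univ _)
  simp only [hzero', zero_mul]

/-- perfect e-stops. If `Ŝ` contains every state with positive hitting
probability under the expert, then the optimal policy of the e-stop MDP is at least as
good as the expert in the true MDP. -/
theorem perfect_estop
    {S A : Type*} [Fintype S] [DecidableEq S] [Fintype A]
    (M : MDP S A) (πe : Policy S A) (Shat : Finset S)
    (hcover : ∀ s : S, 0 < hitProb M πe s → s ∈ Shat)
    (πhatstar : Policy S A)
    (hπhatstar : ∀ π : Policy S A, estopJ M Shat π ≤ estopJ M Shat πhatstar) :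
    M.J πe ≤ M.J πhatstar := by
  have hsupp : ∀ t < M.H, ∀ s, s ∉ Shat → stateDist M.P πe.p M.ρ0 t s = 0 := by
    intro t ht s hs
    by_contra hne
    exact hs (hcover s (hitProb_pos_of_stateDist_pos M πe ht
      ((stateDist_nonneg M πe t s).lt_of_ne' hne)))
  calc M.J πe = estopJ M Shat πe := (estopJ_eq_J M Shat πe hsupp).symm
    _ ≤ estopJ M Shat πhatstar := hπhatstar πe
    _ ≤ M.J πhatstar := estopJ_le_J M Shat πhatstar
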